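/- arXiv:1312.5020 — 3 statements merged into one kernel-verified Lean document; each statement's English description precedes it below -/
import Mathlib

section
/- For all integers M ≥ 2 and N ≥ 2, the ratio (log M)/(log N) is a rational number if and only if there exist integers k ≥ 2, a ≥ 1, b ≥ 1 with M = k^a and N = k^b. Consequently, the ratio of two scale pitches is irrational unless the corresponding integers are powers of a common base. -/
/-- For integers M, N ≥ 2, (log M)/(log N) is rational iff M and N are powers
of a common base k ≥ 2. -/
theorem log_ratio_rational_iff_common_base (M N : ℕ) (hM : 2 ≤ M) (hN : 2 ≤ N) :
    (∃ q : ℚ, Real.log M / Real.log N = (q : ℝ)) ↔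
      ∃ k a b : ℕ, 2 ≤ k ∧ 1 ≤ a ∧ 1 ≤ b ∧ M = k ^ a ∧ N = k ^ b := by
  have hlogM : 0 < Real.log M := Real.log_pos (by exact_mod_cast hM)
  have hlogN : 0 < Real.log N := Real.log_pos (by exact_mod_cast hN)
  constructor
  · rintro ⟨q, hq⟩
    have hq_pos : 0 < q := by
      have : (0 : ℝ) < q := hq ▸ div_pos hlogM hlogN
      exact_mod_cast this
    obtain ⟨n, hn⟩ := Int.eq_ofNat_of_zero_le (Rat.num_pos.mpr hq_pos).le
    have hcop : q.den.Coprime n := by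
      simpa [hn] using q.reduced.symm
    have hlog : (q.den : ℝ) * Real.log M = n * Real.log N := by
      have hden : (q.den : ℝ) ≠ 0 := by exact_mod_cast q.den_nz
      rw [Rat.cast_def, hn, Int.cast_natCast, div_eq_div_iff hlogN.ne' hden] at hq
      linarith
    have hpow : M ^ q.den = N ^ n := by
      rw [← Real.log_pow, ← Real.log_pow] at hlog
      have := Real.log_injOn_pos (Set.mem_Ioi.mpr (by positivity))
        (Set.mem_Ioi.mpr (by positivity)) hlog
      exact_mod_cast this
    obtain ⟨k, hkM, hkN⟩ :=
      Nat.exists_eq_pow_of_exponent_coprime_of_pow_eq_pow hcop hpow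
    have hn_pos : n ≠ 0 := by
      rintro rfl
      simp at hkM
      omega
    refine ⟨k, n, q.den, ?_, Nat.one_le_iff_ne_zero.mpr hn_pos, q.den_pos, hkM, hkN⟩
    by_contra! hk
    have := Nat.pow_le_one_iff hn_pos |>.mpr (Nat.le_of_lt_succ hk)
    omega
  · rintro ⟨k, a, b, hk, -, -, rfl, rfl⟩
    have hlogk : Real.log k ≠ 0 := (Real.log_pos (by exact_mod_cast hk)).ne'
    refine ⟨a / b, ?_⟩
    push_cast
    rw [Real.log_pow, Real.log_pow, mul_div_mul_right _ _ hlogk]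
end

section
/- For all integers M, N with 4 ≤ M < N ≤ 15, the ratio (log N)/(log M) is rational if and only if M = 4 and N = 8 (in which case the ratio is 3/2). That is, among the twelve keyboard tones 4*, 5*, …, 15*, the only rational interval between distinct tones is the perfect fifth between 4* and 8*. -/
/-- If `log N / log M` is rational, then some positive powers of `M` and `N` agree. -/
theorem exists_pow_eq_pow_of_log_div_log_rat {M N : ℕ} (hM : 1 < M) (hN : 1 < N) {q : ℚ}
    (hq : Real.log N / Real.log M = (q : ℝ)) :
    ∃ a b : ℕ, a ≠ 0 ∧ b ≠ 0 ∧ M ^ a = N ^ b := by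
  have hlM : 0 < Real.log M := Real.log_pos (by exact_mod_cast hM)
  have hlN : 0 < Real.log N := Real.log_pos (by exact_mod_cast hN)
  have hq0 : 0 < q := by
    have : (0 : ℝ) < q := hq ▸ div_pos hlN hlM
    exact_mod_cast this
  have hnum : 0 < q.num := Rat.num_pos.mpr hq0
  obtain ⟨a, ha⟩ := Int.eq_ofNat_of_zero_le hnum.le
  refine ⟨a, q.den, by omega, q.den_nz, ?_⟩
  have hden : (q.den : ℝ) ≠ 0 := by exact_mod_cast q.den_nz
  have hlog : (a : ℝ) * Real.log M = q.den * Real.log N := by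
    rw [Rat.cast_def, ha, Int.cast_natCast] at hq
    field_simp at hq
    linarith
  rw [← Real.log_pow, ← Real.log_pow] at hlog
  have hpow : (M : ℝ) ^ a = (N : ℝ) ^ q.den :=
    Real.log_injOn_pos (Set.mem_Ioi.mpr (by positivity)) (Set.mem_Ioi.mpr (by positivity)) hlog
  exact_mod_cast hpow

/-- Numbers with a common positive power have the same prime divisors. -/
theorem Nat.Prime.dvd_iff_dvd_of_pow_eq_pow {p M N a b : ℕ} (hp : p.Prime) (ha : a ≠ 0)
    (hb : b ≠ 0) (h : M ^ a = N ^ b) : p ∣ M ↔ p ∣ N := by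
  rw [← hp.prime.dvd_pow_iff_dvd ha, h, hp.prime.dvd_pow_iff_dvd hb]

theorem six_pow_ne_twelve_pow {a b : ℕ} (hb : b ≠ 0) : 6 ^ a ≠ 12 ^ b := by
  intro h
  have hfac : 2 ^ a * 3 ^ a = 2 ^ (2 * b) * 3 ^ b := by
    rw [pow_mul, ← mul_pow, ← mul_pow]
    exact h
  have : Fact (Nat.Prime 3) := ⟨Nat.prime_three⟩
  have h2 := congrArg (padicValNat 2) hfac
  have h3 := congrArg (padicValNat 3) hfac
  rw [padicValNat_mul_pow_left _ _ (by decide), padicValNat_mul_pow_left _ _ (by decide)] at h2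
  rw [padicValNat_mul_pow_right _ _ (by decide), padicValNat_mul_pow_right _ _ (by decide)] at h3
  omega

theorem log_eight_div_log_four : Real.log 8 / Real.log 4 = 3 / 2 := by
  have h2 : Real.log 2 ≠ 0 := (Real.log_pos one_lt_two).ne'
  rw [show (8 : ℝ) = 2 ^ 3 by norm_num, show (4 : ℝ) = 2 ^ 2 by norm_num, Real.log_pow,
    Real.log_pow]
  push_cast
  field_simp

/-- Among the keyboard tones 4*,…,15*, the only rational interval between
distinct tones is the perfect fifth between 4* and 8*, with ratio 3/2. -/
theorem keyboard_rational_interval_iff (M N : ℕ) (h4 : 4 ≤ M) (hMN : M < N) (h15 : N ≤ 15) :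
    ((∃ q : ℚ, Real.log N / Real.log M = (q : ℝ)) ↔ M = 4 ∧ N = 8) ∧
      Real.log 8 / Real.log 4 = 3 / 2 := by
  refine ⟨⟨?_, ?_⟩, log_eight_div_log_four⟩
  · rintro ⟨q, hq⟩
    obtain ⟨a, b, ha, hb, h⟩ :=
      exists_pow_eq_pow_of_log_div_log_rat (by omega) (by omega) hq
    have hdvd {p : ℕ} (hp : p.Prime) : p ∣ M ↔ p ∣ N := hp.dvd_iff_dvd_of_pow_eq_pow ha hb h
    have h2 := hdvd Nat.prime_two
    have h3 := hdvd Nat.prime_three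
    have h5 := hdvd Nat.prime_five
    have h7 := hdvd (p := 7) (by norm_num)
    have h11 := hdvd (p := 11) (by norm_num)
    have h13 := hdvd (p := 13) (by norm_num)
    have hcases : (M = 4 ∧ N = 8) ∨ (M = 6 ∧ N = 12) := by
      clear hq h hdvd
      have hM : M ≤ 15 := by omega
      interval_cases M <;> interval_cases N <;> omega
    rcases hcases with h48 | ⟨rfl, rfl⟩
    · exact h48
    · exact absurd h (six_pow_ne_twelve_pow hb)
  · rintro ⟨rfl, rfl⟩
    exact ⟨3 / 2, by push_cast; exact log_eight_div_log_four⟩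
end

section
/- For every integer k, the real number 2^(k/12) is not equal to 3/2; that is, the perfect fifth interval 3/2 appearing in the logarithmic scale (as the ratio of tone 8* to tone 4*) is not an interval of the twelve-tone equal-tempered scale. -/
/-- The perfect fifth 3/2 is not an interval of twelve-tone equal temperament:
for every integer k, 2^(k/12) ≠ 3/2. -/
theorem perfect_fifth_not_equal_tempered (k : ℤ) :
    (2 : ℝ) ^ ((k : ℝ) / 12) ≠ 3 / 2 := by
  intro h
  have hk : (2 : ℝ) ^ k = (3 / 2) ^ 12 := by
    rw [← h, ← Real.rpow_natCast, ← Real.rpow_mul (by norm_num), ← Real.rpow_intCast]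
    congr 1
    push_cast
    ring
  -- `(3 / 2) ^ 12 ≈ 129.7` lies strictly between `2 ^ 7` and `2 ^ 8`.
  have lower : 7 < k := by
    rw [← zpow_lt_zpow_iff_right₀ (one_lt_two : (1 : ℝ) < 2), hk]
    norm_num
  have upper : k < 8 := by
    rw [← zpow_lt_zpow_iff_right₀ (one_lt_two : (1 : ℝ) < 2), hk]
    norm_num
  omega
end
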